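/- arXiv:1110.3346 — 3 statements merged into one kernel-verified Lean document; each statement's English description precedes it below -/
import Mathlib

section
/- Let R be a commutative ring, n ≥ 1, and a_1, …, a_n ∈ R. The polynomial evaluation maps X ↦ a_i induce a well-defined R-algebra homomorphism R[X]/(∏_{i=1}^n (X − a_i)) → ∏_{i=1}^n R. This homomorphism is bijective if and only if a_i − a_j is a unit of R for all i ≠ j. -/
open Polynomial

/-- If the differences of the `a i` are units, a polynomial vanishing at every `a i` is divisible
by `∏ (X - a i)`. -/
theorem prod_X_sub_C_dvd_of_isUnit_sub {R ι : Type*} [CommRing R] [Fintype ι] {a : ι → R}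
    (h : ∀ i j, i ≠ j → IsUnit (a i - a j)) {p : R[X]} (hp : ∀ i, p.eval (a i) = 0) :
    ∏ i, (X - C (a i)) ∣ p :=
  Fintype.prod_dvd_of_coprime (fun i j hij => isCoprime_X_sub_C_of_isUnit_sub (h i j hij))
    fun i => dvd_iff_isRoot.mpr (hp i)

/-- Lagrange interpolation over a commutative ring, at nodes whose differences are units. -/
theorem exists_eval_eq_of_isUnit_sub {R ι : Type*} [CommRing R] [Fintype ι] {a : ι → R}
    (h : ∀ i j, i ≠ j → IsUnit (a i - a j)) (v : ι → R) :
    ∃ p : R[X], ∀ i, p.eval (a i) = v i := by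
  classical
  refine ⟨∑ k, C (v k) * ∏ j ∈ Finset.univ.erase k,
    (C (Ring.inverse (a k - a j)) * (X - C (a j))), fun i => ?_⟩
  simp only [eval_finsetSum, eval_mul, eval_C, eval_prod, eval_sub, eval_X]
  rw [Finset.sum_eq_single i]
  · rw [Finset.prod_eq_one, mul_one]
    intro j hj
    exact Ring.inverse_mul_cancel _ (h i j (Finset.ne_of_mem_erase hj).symm)
  · intro k _ hk
    rw [Finset.prod_eq_zero (Finset.mem_erase.mpr ⟨hk.symm, Finset.mem_univ i⟩) (by simp),
      mul_zero]
  · simp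

/-- For `a_1, …, a_n ∈ R`, evaluation at the `a_i` induces a well-defined `R`-algebra
homomorphism `R[X]/(∏ (X - a_i)) → ∏_{i=1}^n R`, and this homomorphism is bijective if and
only if `a_i - a_j` is a unit for all `i ≠ j`. -/
theorem stmt2 (R : Type*) [CommRing R] (n : ℕ) (hn : 1 ≤ n) (a : Fin n → R) :
    ∃ ψ : (R[X] ⧸ Ideal.span {∏ i : Fin n, (X - C (a i))}) →ₐ[R] (Fin n → R),
      (∀ p : R[X],
        ψ (Ideal.Quotient.mk (Ideal.span {∏ i : Fin n, (X - C (a i))}) p) =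
          fun i : Fin n => p.eval (a i)) ∧
      (Function.Bijective ψ ↔ ∀ i j : Fin n, i ≠ j → IsUnit (a i - a j)) := by
  have aeval_eq (p : R[X]) : aeval a p = fun i => p.eval (a i) := by
    ext i
    rw [aeval_pi_apply₂, coe_aeval_eq_eval]
  have aeval_eq_zero : ∀ p ∈ Ideal.span {∏ i : Fin n, (X - C (a i))}, aeval a p = 0 := by
    intro p hp
    rw [aeval_eq]
    ext i
    exact dvd_iff_isRoot.mp ((Finset.dvd_prod_of_mem (fun i => X - C (a i))
      (Finset.mem_univ i)).trans (Ideal.mem_span_singleton.mp hp))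
  let ψ := Ideal.Quotient.liftₐ (Ideal.span {∏ i : Fin n, (X - C (a i))})
    (aeval (R := R) a) aeval_eq_zero
  have ψ_mk (p : R[X]) : ψ (Ideal.Quotient.mk _ p) = fun i => p.eval (a i) := aeval_eq p
  refine ⟨ψ, ψ_mk, fun hψ i j hij => ?_, fun h => ⟨?_, fun v => ?_⟩⟩
  · obtain ⟨q, hq⟩ := hψ.surjective (Pi.single i 1)
    obtain ⟨p, rfl⟩ := Ideal.Quotient.mk_surjective q
    rw [ψ_mk] at hq
    have hi : p.eval (a i) = 1 := by simpa using congrFun hq i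
    have hj : p.eval (a j) = 0 := by simpa [hij.symm] using congrFun hq j
    simpa [hi, hj, isUnit_iff_dvd_one] using sub_dvd_eval_sub (a i) (a j) p
  · refine (injective_iff_map_eq_zero ψ).mpr fun q hq => ?_
    obtain ⟨p, rfl⟩ := Ideal.Quotient.mk_surjective q
    rw [ψ_mk] at hq
    exact Ideal.Quotient.eq_zero_iff_mem.mpr (Ideal.mem_span_singleton.mpr
      (prod_X_sub_C_dvd_of_isUnit_sub h (congrFun hq)))
  · obtain ⟨p, hp⟩ := exists_eval_eq_of_isUnit_sub h v
    exact ⟨Ideal.Quotient.mk _ p, (ψ_mk p).trans (funext hp)⟩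
end

section
/- Let R be a commutative ring and I an ideal of R contained in the Jacobson radical of R. Let g, h ∈ R[X] be monic polynomials such that the reductions of g and h modulo I are coprime in (R/I)[X] (i.e. generate the unit ideal of (R/I)[X]). Then the natural R-algebra homomorphism R[X]/(g·h) → R[X]/(g) × R[X]/(h) is bijective. -/
open Polynomial

/-- Over a commutative ring, a monic polynomial `g` is coprime to any polynomial to which it is
coprime modulo an ideal contained in the Jacobson radical. -/
theorem Polynomial.Monic.isCoprime_of_isCoprime_map_mk {R : Type*} [CommRing R] {I : Ideal R}
    (hI : I ≤ (⊥ : Ideal R).jacobson) {g h : R[X]} (hg : g.Monic)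
    (hcop : IsCoprime (g.map (Ideal.Quotient.mk I)) (h.map (Ideal.Quotient.mk I))) :
    IsCoprime g h := by
  obtain ⟨a', b', hab⟩ := hcop
  obtain ⟨a, rfl⟩ := map_surjective _ Ideal.Quotient.mk_surjective a'
  obtain ⟨b, rfl⟩ := map_surjective _ Ideal.Quotient.mk_surjective b'
  have hr : a * g + b * h - 1 ∈ I.map (algebraMap R R[X]) := by
    refine Ideal.mem_map_C_iff.2 fun n => Ideal.Quotient.eq_zero_iff_mem.1 ?_
    rw [← coeff_map]
    simp [hab]
  have : Module.Finite R (R[X] ⧸ Ideal.span {g}) := hg.finite_quotient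
  let π := Ideal.Quotient.mk (Ideal.span {g})
  have hπg : π g = 0 := Ideal.Quotient.eq_zero_iff_mem.2 (Ideal.mem_span_singleton_self g)
  have hrπ : π (b * h - 1) ∈ I.map (algebraMap R (R[X] ⧸ Ideal.span {g})) := by
    have := Ideal.mem_map_of_mem π hr
    rw [Ideal.map_map, show π.comp (algebraMap R R[X]) =
      algebraMap R (R[X] ⧸ Ideal.span {g}) from rfl] at this
    simpa [hπg] using this
  have htop : (⊤ : Submodule R (R[X] ⧸ Ideal.span {g})) ≤
      (Ideal.span {π h}).restrictScalars R := by
    refine Submodule.le_of_le_smul_of_le_jacobson_bot Module.Finite.fg_top hI fun x _ => ?_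
    rw [Ideal.smul_top_eq_map]
    refine Submodule.mem_sup.2 ⟨x * π b * π h, Ideal.mul_mem_left _ _
      (Ideal.mem_span_singleton_self _), -(x * π (b * h - 1)),
      neg_mem (Ideal.mul_mem_left _ x hrπ), ?_⟩
    simp only [map_sub, map_mul, map_one]
    ring
  obtain ⟨c, hc⟩ := Ideal.mem_span_singleton'.1 (htop (Submodule.mem_top (x := 1)))
  obtain ⟨c, rfl⟩ := Ideal.Quotient.mk_surjective c
  rw [← map_mul, ← map_one π, Ideal.Quotient.eq, Ideal.mem_span_singleton'] at hc
  obtain ⟨d, hd⟩ := hc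
  exact ⟨-d, c, by linear_combination -hd⟩

/-- If `g, h ∈ R[X]` are monic and their reductions modulo an ideal `I` contained in the
Jacobson radical of `R` are coprime in `(R/I)[X]`, then the natural map
`R[X]/(g·h) → R[X]/(g) × R[X]/(h)` is bijective. -/
theorem stmt4 (R : Type*) [CommRing R] (I : Ideal R)
    (hI : I ≤ (⊥ : Ideal R).jacobson)
    (g h : R[X]) (hg : g.Monic) (hh : h.Monic)
    (hcop : IsCoprime (g.map (Ideal.Quotient.mk I)) (h.map (Ideal.Quotient.mk I))) :
    ∃ ψ : (R[X] ⧸ Ideal.span {g * h}) →ₐ[R]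
        (R[X] ⧸ Ideal.span {g}) × (R[X] ⧸ Ideal.span {h}),
      (∀ p : R[X],
        ψ (Ideal.Quotient.mk (Ideal.span {g * h}) p) =
          (Ideal.Quotient.mk (Ideal.span {g}) p, Ideal.Quotient.mk (Ideal.span {h}) p)) ∧
      Function.Bijective ψ := by
  have hgh : IsCoprime g h := hg.isCoprime_of_isCoprime_map_mk hI hcop
  let φ : R[X] →ₐ[R] (R[X] ⧸ Ideal.span {g}) × (R[X] ⧸ Ideal.span {h}) :=
    (Ideal.Quotient.mkₐ R _).prod (Ideal.Quotient.mkₐ R _)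
  have hφ (p : R[X]) : φ p = 0 ↔ g ∣ p ∧ h ∣ p := by
    simp [φ, Prod.ext_iff, Ideal.Quotient.eq_zero_iff_mem, Ideal.mem_span_singleton]
  refine ⟨Ideal.Quotient.liftₐ _ φ fun p hp => ?_, fun p => rfl, ?_, ?_⟩
  · rw [Ideal.mem_span_singleton] at hp
    exact (hφ p).2 ⟨dvd_of_mul_right_dvd hp, dvd_of_mul_left_dvd hp⟩
  · refine (injective_iff_map_eq_zero _).2 fun x hx => ?_
    obtain ⟨p, rfl⟩ := Ideal.Quotient.mk_surjective x
    obtain ⟨h₁, h₂⟩ := (hφ p).1 hx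
    exact Ideal.Quotient.eq_zero_iff_mem.2 (Ideal.mem_span_singleton.2 (hgh.mul_dvd h₁ h₂))
  · rintro ⟨x, y⟩
    obtain ⟨p, rfl⟩ := Ideal.Quotient.mk_surjective x
    obtain ⟨q, rfl⟩ := Ideal.Quotient.mk_surjective y
    obtain ⟨a, b, hab⟩ := hgh
    refine ⟨Ideal.Quotient.mk _ (p * (b * h) + q * (a * g)), Prod.ext ?_ ?_⟩
    · refine Ideal.Quotient.eq.2 (Ideal.mem_span_singleton'.2 ⟨(q - p) * a, ?_⟩)
      linear_combination -p * hab
    · refine Ideal.Quotient.eq.2 (Ideal.mem_span_singleton'.2 ⟨(p - q) * b, ?_⟩)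
      linear_combination -q * hab
end

section
/- Let G be a group, H a commutative subgroup of G, and Γ a group. Let Fix^G(G/H) be the set of pairs (α, x), where α : Γ → G is a group homomorphism and x ∈ G/H is a coset fixed by every element of the range of α, with G acting by g·(α, x) = (gαg^{−1}, g·x). Let H act on the set Hom(Γ, H) of group homomorphisms by pointwise conjugation (this action is trivial since H is commutative). Then the action groupoid (transport category) of G acting on Fix^G(G/H) is equivalent, as a category, to the action groupoid of H acting on Hom(Γ, H). -/
open CategoryTheory

/-- The `G`-set `Fix^G(G/H) = ∐_{α : Γ →* G} (G/H)^{im α}`: pairs of a homomorphism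
`α : Γ →* G` and a coset of `H` fixed by every element of the range of `α`. -/
def FixGH (G Γ : Type*) [Group G] [Group Γ] (H : Subgroup G) : Type _ :=
  {p : (Γ →* G) × (G ⧸ H) // ∀ γ : Γ, p.1 γ • p.2 = p.2}

/-- `G` acts on `Fix^G(G/H)` by conjugating the homomorphism and translating the coset. -/
instance FixGH.mulAction (G Γ : Type*) [Group G] [Group Γ] (H : Subgroup G) :
    MulAction G (FixGH G Γ H) where
  smul g p := ⟨⟨(MulAut.conj g).toMonoidHom.comp p.1.1, g • p.1.2⟩, by
    intro γ
    show (MulAut.conj g) (p.1.1 γ) • g • p.1.2 = g • p.1.2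
    rw [MulAut.conj_apply, smul_smul]
    have hg : g * p.1.1 γ * g⁻¹ * g = g * p.1.1 γ := by group
    rw [hg, mul_smul, p.2 γ]⟩
  one_smul p := by
    refine Subtype.ext (Prod.ext ?_ ?_)
    · ext γ
      show (MulAut.conj (1 : G)) (p.1.1 γ) = p.1.1 γ
      simp
    · exact one_smul G p.1.2
  mul_smul g₁ g₂ p := by
    refine Subtype.ext (Prod.ext ?_ ?_)
    · ext γ
      show (MulAut.conj (g₁ * g₂)) (p.1.1 γ) = (MulAut.conj g₁) ((MulAut.conj g₂) (p.1.1 γ))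
      simp [MulAut.conj_apply]
    · exact mul_smul g₁ g₂ p.1.2

/-- A group `K` acts on `Hom(Γ, K)` by pointwise conjugation. -/
instance MonoidHom.conjMulAction (Γ K : Type*) [Group Γ] [Group K] :
    MulAction K (Γ →* K) where
  smul k α := (MulAut.conj k).toMonoidHom.comp α
  one_smul α := by
    ext γ
    show (MulAut.conj (1 : K)) (α γ) = α γ
    simp
  mul_smul k₁ k₂ α := by
    ext γ
    show (MulAut.conj (k₁ * k₂)) (α γ) = (MulAut.conj k₁) ((MulAut.conj k₂) (α γ))
    simp [MulAut.conj_apply]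

/-- An action-compatible map of sets along a group homomorphism induces a functor between
action groupoids. -/
def actionCategoryMap {K G X Y : Type*} [Group K] [Group G] [MulAction K X] [MulAction G Y]
    (φ : K →* G) (f : X → Y) (hf : ∀ (k : K) (x : X), f (k • x) = φ k • f x) :
    ActionCategory K X ⥤ ActionCategory G Y where
  obj x := ((f x.back : Y) : ActionCategory G Y)
  map {x _} k := ⟨φ k.val, (hf k.val x.back).symm.trans (congrArg f k.property)⟩
  map_id _ := Subtype.ext φ.map_one
  map_comp k l := Subtype.ext (φ.map_mul l.val k.val)

theorem actionCategoryMap_isEquivalence {K G X Y : Type*} [Group K] [Group G] [MulAction K X]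
    [MulAction G Y] (φ : K →* G) (f : X → Y) (hf : ∀ (k : K) (x : X), f (k • x) = φ k • f x)
    (hφ : Function.Injective φ)
    (hfull : ∀ (x y : X) (g : G), g • f x = f y → ∃ k : K, k • x = y ∧ φ k = g)
    (hsurj : ∀ y : Y, ∃ (x : X) (g : G), g • f x = y) :
    (actionCategoryMap φ f hf).IsEquivalence where
  faithful := ⟨fun h => Subtype.ext (hφ (congrArg Subtype.val h))⟩
  full := ⟨fun {x y} g => by
    obtain ⟨k, hk, hkg⟩ := hfull x.back y.back g.val g.property
    exact ⟨⟨k, hk⟩, Subtype.ext hkg⟩⟩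
  essSurj := ⟨fun y => by
    obtain ⟨x, g, hg⟩ := hsurj y.back
    let m : (actionCategoryMap φ f hf).obj (x : ActionCategory K X) ⟶ y := ⟨g, hg⟩
    exact ⟨x, ⟨Groupoid.isoEquivHom _ _ |>.symm m⟩⟩⟩

/-- A homomorphism `Γ →* H`, viewed as a homomorphism to `G` fixing the trivial coset. -/
def FixGH.ofHom {G Γ : Type*} [Group G] [Group Γ] (H : Subgroup G) (α : Γ →* H) :
    FixGH G Γ H :=
  ⟨(H.subtype.comp α, ((1 : G) : G ⧸ H)), fun γ => by
    show (((α γ : G) * 1 : G) : G ⧸ H) = ((1 : G) : G ⧸ H)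
    rw [eq_comm, QuotientGroup.eq]
    simp⟩

theorem FixGH.ofHom_smul {G Γ : Type*} [Group G] [Group Γ] (H : Subgroup G) (h : H)
    (α : Γ →* H) : ofHom H (h • α) = H.subtype h • ofHom H α := by
  refine Subtype.ext (Prod.ext rfl ?_)
  show ((1 : G) : G ⧸ H) = (((h : G) * 1 : G) : G ⧸ H)
  rw [QuotientGroup.eq]
  simp

theorem FixGH.exists_smul_eq_of_smul_ofHom_eq {G Γ : Type*} [Group G] [Group Γ]
    (H : Subgroup G) (α β : Γ →* H) (g : G) (hg : g • ofHom H α = ofHom H β) :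
    ∃ h : H, h • α = β ∧ H.subtype h = g := by
  have hcoset : ((g * 1 : G) : G ⧸ H) = ((1 : G) : G ⧸ H) := congrArg (fun p => p.1.2) hg
  have hmem : g ∈ H := by
    rw [eq_comm, QuotientGroup.eq] at hcoset
    simpa using hcoset
  refine ⟨⟨g, hmem⟩, ?_, rfl⟩
  ext γ
  exact DFunLike.congr_fun (congrArg (fun p => p.1.1) hg) γ

theorem FixGH.exists_smul_ofHom_eq {G Γ : Type*} [Group G] [Group Γ] (H : Subgroup G)
    (p : FixGH G Γ H) : ∃ (α : Γ →* H) (g : G), g • ofHom H α = p := by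
  obtain ⟨⟨α, x⟩, hp⟩ := p
  obtain ⟨g, rfl⟩ := QuotientGroup.mk_surjective x
  have hmem (γ : Γ) : (MulAut.conj g⁻¹).toMonoidHom.comp α γ ∈ H := by
    have h : ((α γ * g : G) : G ⧸ H) = (g : G ⧸ H) := hp γ
    rw [eq_comm, QuotientGroup.eq] at h
    simpa [mul_assoc] using h
  refine ⟨((MulAut.conj g⁻¹).toMonoidHom.comp α).codRestrict H hmem, g,
    Subtype.ext (Prod.ext ?_ ?_)⟩
  · ext γ
    show g * (g⁻¹ * α γ * g⁻¹⁻¹) * g⁻¹ = α γ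
    group
  · show ((g * 1 : G) : G ⧸ H) = (g : G ⧸ H)
    rw [mul_one]

/-- For `H` a commutative subgroup of `G`, the action groupoid of `G` acting on
`Fix^G(G/H)` is equivalent to the action groupoid of `H` acting (by pointwise conjugation,
a trivial action) on `Hom(Γ, H)`. -/
theorem stmt5 (G Γ : Type*) [Group G] [Group Γ] (H : Subgroup G)
    (hH : ∀ a b : H, a * b = b * a) :
    Nonempty (ActionCategory G (FixGH G Γ H) ≌ ActionCategory H (Γ →* H)) := by
  have := actionCategoryMap_isEquivalence H.subtype (FixGH.ofHom (Γ := Γ) H)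
    (FixGH.ofHom_smul H) H.subtype_injective (FixGH.exists_smul_eq_of_smul_ofHom_eq H)
    (FixGH.exists_smul_ofHom_eq H)
  exact ⟨(actionCategoryMap H.subtype (FixGH.ofHom (Γ := Γ) H)
    (FixGH.ofHom_smul H)).asEquivalence.symm⟩
end
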